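/- (Corollary: cup(F) is a retract of TL) Let F ⊆ {0, …, n−1} be an innermost set which is not the unique maximal innermost set (i.e., if n is odd then F ≠ {0, 2, 4, …, n−1}). Then the inclusion cup(F) ↪ TL_{n+1}(a) is a retract of left TL_{n+1}(a)-modules: there exists a morphism of left TL_{n+1}(a)-modules r : TL_{n+1}(a) → cup(F) whose composite with the inclusion is the identity of cup(F). -/

import Mathlib

open CategoryTheory

/-- The defining relations of the Temperley–Lieb algebra on `n+1` strands (with `n` generators
`U_0, …, U_{n-1}`), inside the free algebra on `Fin n`. -/
inductive TLRel (R : Type) [CommRing R] (a : R) (n : ℕ) :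
    FreeAlgebra R (Fin n) → FreeAlgebra R (Fin n) → Prop
  | comm (i j : Fin n) (h : (i : ℕ) + 2 ≤ j ∨ (j : ℕ) + 2 ≤ i) :
      TLRel R a n (FreeAlgebra.ι R i * FreeAlgebra.ι R j)
        (FreeAlgebra.ι R j * FreeAlgebra.ι R i)
  | braid (i j : Fin n) (h : (i : ℕ) = (j : ℕ) + 1 ∨ (j : ℕ) = (i : ℕ) + 1) :
      TLRel R a n (FreeAlgebra.ι R i * FreeAlgebra.ι R j * FreeAlgebra.ι R i)
        (FreeAlgebra.ι R i)
  | idem (i : Fin n) :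
      TLRel R a n (FreeAlgebra.ι R i * FreeAlgebra.ι R i) (a • FreeAlgebra.ι R i)

/-- The Temperley–Lieb algebra `TL_{n+1}(a)` on `n+1` strands: the quotient of the free
`R`-algebra on `n` generators by the Temperley–Lieb relations. -/
abbrev TL (R : Type) [CommRing R] (a : R) (n : ℕ) : Type := RingQuot (TLRel R a n)

variable (R : Type) [CommRing R] (a : R) (n : ℕ)

/-- The generators `U_i` of the Temperley–Lieb algebra. -/
noncomputable def U (i : Fin n) : TL R a n :=
  RingQuot.mkAlgHom R (TLRel R a n) (FreeAlgebra.ι R i)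

/-- A set `F` of generator indices is *innermost* if its elements are pairwise at distance
at least `2`, i.e. `|i - j| ≥ 2` for all distinct `i, j ∈ F`. -/
def Innermost (n : ℕ) (F : Finset (Fin n)) : Prop :=
  ∀ i ∈ F, ∀ j ∈ F, i ≠ j → 2 ≤ ((i : ℤ) - (j : ℤ)).natAbs

/-- The set `{0, 2, 4, …}` of even indices in `{0, …, n-1}`; for `n` odd this is the unique
maximal innermost set `M = {0, 2, …, n-1}`. -/
def Mset (n : ℕ) : Finset (Fin n) := Finset.univ.filter (fun i : Fin n => (i : ℕ) % 2 = 0)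

/-- The product `∏_{i ∈ F} U_i`, taken in increasing order of the indices (for an innermost
set `F` the factors pairwise commute, so the order is immaterial). -/
noncomputable def cupGen (F : Finset (Fin n)) : TL R a n :=
  ((F.sort (· ≤ ·)).map (U R a n)).prod

/-- The cup module `cup(F)`: the left ideal of `TL` generated by `∏_{i ∈ F} U_i`.
In particular `cup(∅) = TL`. -/
noncomputable def cup (F : Finset (Fin n)) : Submodule (TL R a n) (TL R a n) :=
  Submodule.span (TL R a n) {cupGen R a n F}

theorem U_comm' (i j : Fin n) (h : (i : ℕ) + 2 ≤ j ∨ (j : ℕ) + 2 ≤ i) :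
    U R a n i * U R a n j = U R a n j * U R a n i := by
  have := RingQuot.mkAlgHom_rel R (TLRel.comm (R := R) (a := a) i j h)
  simpa [U] using this

theorem U_braid' (i j : Fin n) (h : (i : ℕ) = (j : ℕ) + 1 ∨ (j : ℕ) = (i : ℕ) + 1) :
    U R a n i * U R a n j * U R a n i = U R a n i := by
  have := RingQuot.mkAlgHom_rel R (TLRel.braid (R := R) (a := a) i j h)
  simpa [U] using this

theorem list_regular {A ι : Type} [Ring A] (x y : ι → A) (L : List ι)
    (hxy : ∀ i ∈ L, x i * y i * x i = x i)
    (hp : L.Pairwise (fun i j => Commute (x i) (x j) ∧ Commute (x i) (y j))) :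
    (L.map x).prod * (L.map y).prod * (L.map x).prod = (L.map x).prod := by
  induction L with
  | nil => simp
  | cons i L ih =>
    rw [List.pairwise_cons] at hp
    have ih := ih (fun j hj => hxy j (by simp [hj])) hp.2
    have hi := hxy i (by simp)
    have c1 : Commute (x i) (L.map x).prod := by
      apply Commute.list_prod_right
      intro z hz
      obtain ⟨j, hj, rfl⟩ := List.mem_map.1 hz
      exact (hp.1 j hj).1
    have c2 : Commute (x i) (L.map y).prod := by
      apply Commute.list_prod_right
      intro z hz
      obtain ⟨j, hj, rfl⟩ := List.mem_map.1 hz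
      exact (hp.1 j hj).2
    simp only [List.map_cons, List.prod_cons]
    generalize (L.map x).prod = P at *
    generalize (L.map y).prod = W at *
    calc x i * P * (y i * W) * (x i * P)
        = (x i * P) * y i * (W * x i) * P := by simp only [mul_assoc]
      _ = P * (x i * y i * x i) * W * P := by
          rw [c1.eq, ← c2.eq]; simp only [mul_assoc]
      _ = (P * x i) * W * P := by rw [hi]
      _ = x i * (P * W * P) := by rw [← c1.eq]; simp only [mul_assoc]
      _ = x i * P := by rw [ih]

theorem exists_free (F : Finset (Fin n)) (hF : Innermost n F)
    (hmax : Odd n → F ≠ Mset n) :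
    ∃ p : ℕ, p ≤ n ∧ ∀ i ∈ F, (i : ℕ) ≠ p ∧ (i : ℕ) + 1 ≠ p := by
  by_contra hcon
  push Not at hcon
  have key : ∀ k : ℕ, 2 * k ≤ n → ∃ i ∈ F, (i : ℕ) = 2 * k := by
    intro k
    induction k with
    | zero =>
      intro h
      obtain ⟨i, hi, h'⟩ := hcon 0 (by omega)
      exact ⟨i, hi, by by_contra h2; have := h' (by omega); omega⟩
    | succ k ih =>
      intro h
      obtain ⟨j, hj, hj'⟩ := ih (by omega)
      obtain ⟨i, hi, h'⟩ := hcon (2 * (k + 1)) h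
      refine ⟨i, hi, ?_⟩
      by_contra h2
      have h3 := h' h2
      have := hF i hi j hj (by intro h; rw [h] at h3; omega)
      omega
  rcases Nat.even_or_odd n with ⟨m, hm⟩ | hodd
  · obtain ⟨i, _, hi⟩ := key m (by omega)
    omega
  · apply hmax hodd
    ext i
    simp only [Mset, Finset.mem_filter, Finset.mem_univ, true_and]
    constructor
    · intro hi
      by_contra hne
      obtain ⟨j, hj, hj'⟩ := key ((i : ℕ) / 2) (by omega)
      have := hF i hi j hj (by intro h; rw [h] at hne; omega)
      omega
    · intro he
      obtain ⟨j, hj, hj'⟩ := key ((i : ℕ) / 2) (by omega)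
      have : j = i := by ext; omega
      exact this ▸ hj

theorem cupGen_regular (F : Finset (Fin n)) (hF : Innermost n F)
    (hmax : Odd n → F ≠ Mset n) :
    ∃ w, cupGen R a n F * w * cupGen R a n F = cupGen R a n F := by
  obtain ⟨p, hpn, hp⟩ := exists_free n F hF hmax
  let φ : Fin n → Fin n := fun i =>
    if h : (i : ℕ) < p ∧ (i : ℕ) + 1 < n then ⟨i + 1, h.2⟩ else ⟨i - 1, by omega⟩
  have φl : ∀ i ∈ F, (i : ℕ) < p → (φ i : ℕ) = i + 1 := by
    intro i hi h
    have := hp i hi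
    have h' : (i : ℕ) < p ∧ (i : ℕ) + 1 < n := by omega
    simp [φ, h']
  have φr : ∀ i ∈ F, p ≤ (i : ℕ) → (φ i : ℕ) + 1 = i := by
    intro i hi h
    have := hp i hi
    have h' : ¬ ((i : ℕ) < p ∧ (i : ℕ) + 1 < n) := by omega
    simp only [φ, dif_neg h']
    omega
  let S : List (Fin n) := F.sort (· ≤ ·)
  let L : List (Fin n) := S.filter (fun i : Fin n => decide ((i : ℕ) < p)) ++
    (S.filter (fun i : Fin n => !decide ((i : ℕ) < p))).reverse
  have hmem : ∀ i, i ∈ S ↔ i ∈ F := fun i => Finset.mem_sort _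
  have hperm : L.Perm S :=
    ((List.reverse_perm _).append_left _).trans (List.filter_append_perm _ S)
  have hlt : S.Pairwise (· < ·) := (Finset.sortedLT_sort F).pairwise
  have hC : ∀ i ∈ F, ∀ j ∈ F, i ≠ j → Commute (U R a n i) (U R a n j) := by
    intro i hi j hj hij
    have := hF i hi j hj hij
    exact U_comm' R a n i j (by omega)
  have hprod : (L.map (U R a n)).prod = cupGen R a n F := by
    refine List.Perm.prod_eq' (hperm.map _) ?_
    rw [List.pairwise_map]
    have hLn : L.Nodup := hperm.nodup_iff.2 (Finset.sort_nodup F _)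
    refine List.Pairwise.imp_of_mem ?_ hLn
    intro i j hi hj hij
    exact hC i ((hmem i).1 (hperm.mem_iff.1 hi)) j ((hmem j).1 (hperm.mem_iff.1 hj)) hij
  refine ⟨(L.map (fun i => U R a n (φ i))).prod, ?_⟩
  rw [← hprod]
  apply list_regular
  · intro i hi
    have hi := (hmem i).1 (hperm.mem_iff.1 hi)
    apply U_braid'
    rcases lt_or_ge (i : ℕ) p with h | h
    · exact Or.inr (φl i hi h)
    · exact Or.inl (φr i hi h).symm
  · have main : ∀ i ∈ F, ∀ j ∈ F, i ≠ j →
        ((i : ℕ) + 2 ≤ φ j ∨ (φ j : ℕ) + 2 ≤ i) →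
        Commute (U R a n i) (U R a n j) ∧ Commute (U R a n i) (U R a n (φ j)) :=
      fun i hi j hj hij h => ⟨hC i hi j hj hij, U_comm' R a n i (φ j) h⟩
    rw [List.pairwise_append]
    refine ⟨?_, ?_, ?_⟩
    · refine List.Pairwise.imp_of_mem ?_ (hlt.filter _)
      intro i j hi hj hij
      simp only [List.mem_filter, hmem, decide_eq_true_eq] at hi hj
      have h1 := φl j hj.1 hj.2
      have h2 := hF i hi.1 j hj.1 hij.ne
      have h3 : (i : ℕ) < j := hij
      exact main i hi.1 j hj.1 hij.ne (by omega)
    · rw [List.pairwise_reverse]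
      refine List.Pairwise.imp_of_mem ?_ (hlt.filter _)
      intro j i hj hi hij
      simp only [List.mem_filter, hmem, Bool.not_eq_true', decide_eq_false_iff_not,
        not_lt] at hi hj
      have h1 := φr j hj.1 hj.2
      have h2 := hF i hi.1 j hj.1 hij.ne'
      have h3 : (j : ℕ) < i := hij
      exact main i hi.1 j hj.1 hij.ne' (by omega)
    · intro i hi j hj
      simp only [List.mem_reverse, List.mem_filter, hmem, Bool.not_eq_true',
        decide_eq_false_iff_not, not_lt, decide_eq_true_eq] at hi hj
      have h1 := φr j hj.1 hj.2
      have h2 := hp i hi.1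
      have h3 := hp j hj.1
      have hne : i ≠ j := by intro h; rw [h] at hi; omega
      exact main i hi.1 j hj.1 hne (by omega)

/-- **Corollary.** If `F` is an innermost set which is not the unique maximal innermost set
(for `n` odd, `F ≠ {0, 2, …, n-1}`; for `n` even the hypothesis is vacuous), then the
inclusion `cup(F) ↪ TL_{n+1}(a)` is a retract of left `TL_{n+1}(a)`-modules. -/
theorem cup_retract_of_TL (hn : 1 ≤ n) (F : Finset (Fin n)) (hF : Innermost n F)
    (hmax : Odd n → F ≠ Mset n) :
    ∃ r : TL R a n →ₗ[TL R a n] ↥(cup R a n F),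
      ∀ c : ↥(cup R a n F), r (c : TL R a n) = c := by
  obtain ⟨w, hw⟩ := cupGen_regular R a n F hF hmax
  refine ⟨LinearMap.codRestrict (cup R a n F)
    (LinearMap.toSpanSingleton (TL R a n) (TL R a n) (w * cupGen R a n F)) ?_, ?_⟩
  · intro c
    rw [LinearMap.toSpanSingleton_apply, smul_eq_mul, ← mul_assoc]
    exact Submodule.mem_span_singleton.2 ⟨c * w, rfl⟩
  · rintro ⟨c, hc⟩
    obtain ⟨y, rfl⟩ := Submodule.mem_span_singleton.1 hc
    apply Subtype.ext
    change y * cupGen R a n F * (w * cupGen R a n F) = y * cupGen R a n F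
    rw [mul_assoc, ← mul_assoc (cupGen R a n F), hw]
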